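/- Let r > 0, r ≠ 1, and equip (0,∞) with the weighted measure μ_r(dx) = x^{−r} dx, writing |h|_{p,r} = ( ∫_0^∞ x^{−r} |h(x)|^p dx )^{1/p}. Define F[g](x) = ∫_0^x y^{−1} g(y) dy when r > 1, and F[g](x) = ∫_x^∞ y^{−1} g(y) dy when r < 1; then the Hardy inequality |F[g]|_{p,r} ≤ (p/|r−1|) |g|_{p,r} holds for p ∈ [1,∞). For ψ ∈ Ψ(1,∞) set ψ_1(p) = p·ψ(p). Then ||F[g]||G(ψ_1) ≤ |r−1|^{−1} ||g||G(ψ) for all ψ and g, and the constant |r−1|^{−1} is best possible: sup_{ψ∈Ψ(1,∞)} sup_{g≠0} ||F[g]||G(ψ_1) / ||g||G(ψ) = |r−1|^{−1}. -/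

import Mathlib

open MeasureTheory Real Set Filter ENNReal

/-- `ψ ∈ Ψ(I)`: continuous, positive, with positive infimum on the exponent set `I`. -/
def PsiClass (I : Set ℝ) (ψ : ℝ → ℝ) : Prop :=
  ContinuousOn ψ I ∧ (∀ p ∈ I, 0 < ψ p) ∧ ∃ ε > 0, ∀ p ∈ I, ε ≤ ψ p

/-- The weighted measure `μ_r(dx) = x^{-r} dx` on `(0,∞)`. -/
noncomputable def muR (r : ℝ) : Measure ℝ :=
  (volume.restrict (Set.Ioi 0)).withDensity fun x => ENNReal.ofReal (x ^ (-r))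

/-- The Bilateral Grand Lebesgue norm `sup_{p ∈ I} |f|_{p,r} / ψ(p)`. -/
noncomputable def BGLS (r : ℝ) (I : Set ℝ) (ψ : ℝ → ℝ) (f : ℝ → ℝ) : ℝ≥0∞ :=
  ⨆ p ∈ I, eLpNorm f (ENNReal.ofReal p) (muR r) / ENNReal.ofReal (ψ p)

/-- The set of `y` over which the Hardy operator with weight `x^{-r}` integrates at `x`. -/
def hardyRegion (r x : ℝ) : Set ℝ := if 1 < r then Set.Ioo 0 x else Set.Ioi x

theorem hardyRegion_subset_Ioi {r x : ℝ} (hx : 0 < x) : hardyRegion r x ⊆ Set.Ioi 0 := by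
  unfold hardyRegion
  split_ifs
  · exact fun y hy => hy.1
  · exact fun y hy => hx.trans hy

theorem measurableSet_hardyRegion (r x : ℝ) : MeasurableSet (hardyRegion r x) := by
  unfold hardyRegion
  split_ifs
  · exact measurableSet_Ioo
  · exact measurableSet_Ioi

theorem measurableSet_hardyRegion_graph (r : ℝ) :
    MeasurableSet {z : ℝ × ℝ | z.2 ∈ hardyRegion r z.1} := by
  unfold hardyRegion
  split_ifs
  · exact (measurableSet_lt measurable_const measurable_snd).inter
      (measurableSet_lt measurable_snd measurable_fst)
  · exact measurableSet_lt measurable_fst measurable_snd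

theorem exists_rat_mem_hardyRegion {r x y : ℝ} (hx : 0 < x) (hy : y ∈ hardyRegion r x) :
    ∃ q : ℚ, y ∈ hardyRegion r q ∧ hardyRegion r q ⊆ hardyRegion r x ∧ (0 : ℝ) < q := by
  unfold hardyRegion at *
  split_ifs at *
  · obtain ⟨q, h1, h2⟩ := exists_rat_btwn hy.2
    exact ⟨q, ⟨hy.1, h1⟩, Set.Ioo_subset_Ioo_right h2.le, hy.1.trans h1⟩
  · obtain ⟨q, h1, h2⟩ := exists_rat_btwn (Set.mem_Ioi.1 hy)
    exact ⟨q, h2, Set.Ioi_subset_Ioi h1.le, hx.trans h1⟩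

theorem lintegral_Ioo_rpow_sub_one {a x : ℝ} (ha : 0 < a) (hx : 0 < x) :
    ∫⁻ y in Set.Ioo 0 x, ENNReal.ofReal (y ^ (a - 1)) = ENNReal.ofReal (x ^ a / a) := by
  have hint : IntegrableOn (fun y : ℝ => y ^ (a - 1)) (Set.Ioo 0 x) :=
    ((intervalIntegrable_iff_integrableOn_Ioc_of_le hx.le).1
      (intervalIntegral.intervalIntegrable_rpow' (by linarith))).mono_set Set.Ioo_subset_Ioc_self
  rw [← ofReal_integral_eq_lintegral_ofReal hint, ← integral_Ioc_eq_integral_Ioo,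
    ← intervalIntegral.integral_of_le hx.le, integral_rpow (Or.inl (by linarith))]
  · simp [Real.zero_rpow ha.ne']
  · exact (ae_restrict_iff' measurableSet_Ioo).2
      (Eventually.of_forall fun y hy => Real.rpow_nonneg hy.1.le _)

theorem lintegral_Ioi_rpow_neg_sub_one {a x : ℝ} (ha : 0 < a) (hx : 0 < x) :
    ∫⁻ y in Set.Ioi x, ENNReal.ofReal (y ^ (-a - 1)) = ENNReal.ofReal (x ^ (-a) / a) := by
  rw [← ofReal_integral_eq_lintegral_ofReal
    (integrableOn_Ioi_rpow_of_lt (by linarith : -a - 1 < -1) hx),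
    integral_Ioi_rpow_of_lt (by linarith) hx]
  · congr 1
    rw [sub_add_cancel, neg_div_neg_eq]
  · exact (ae_restrict_iff' measurableSet_Ioi).2
      (Eventually.of_forall fun y hy => Real.rpow_nonneg (hx.trans hy).le _)

theorem lintegral_hardyRegion_rpow {r k x : ℝ} (hr : r ≠ 1) (hk : 0 < k * (r - 1)) (hx : 0 < x) :
    ∫⁻ y in hardyRegion r x, ENNReal.ofReal (y ^ (k - 1)) = ENNReal.ofReal (x ^ k / |k|) := by
  unfold hardyRegion
  split_ifs with h
  · have hk' : 0 < k := pos_of_mul_pos_left hk (by linarith)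
    rw [lintegral_Ioo_rpow_sub_one hk' hx, abs_of_pos hk']
  · have hk' : k < 0 := by
      have : r < 1 := lt_of_le_of_ne (not_lt.1 h) hr
      nlinarith
    have := lintegral_Ioi_rpow_neg_sub_one (neg_pos.2 hk') hx
    rwa [neg_neg, ← abs_of_neg hk'] at this

theorem lintegral_mem_hardyRegion_rpow {r k y : ℝ} (hr : r ≠ 1) (hk : 0 < k * (r - 1))
    (hy : 0 < y) :
    ∫⁻ x in {x | 0 < x ∧ y ∈ hardyRegion r x}, ENNReal.ofReal (x ^ (-k - 1)) =
      ENNReal.ofReal (y ^ (-k) / |k|) := by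
  unfold hardyRegion
  split_ifs with h
  · have hk' : 0 < k := pos_of_mul_pos_left hk (by linarith)
    have hs : {x | 0 < x ∧ y ∈ Set.Ioo 0 x} = Set.Ioi y := by
      ext x
      exact ⟨fun hx => hx.2.2, fun hx => ⟨hy.trans hx, hy, hx⟩⟩
    rw [hs, lintegral_Ioi_rpow_neg_sub_one hk' hy, abs_of_pos hk']
  · have hk' : k < 0 := by
      have : r < 1 := lt_of_le_of_ne (not_lt.1 h) hr
      nlinarith
    have hs : {x | 0 < x ∧ y ∈ Set.Ioi x} = Set.Ioo 0 y := rfl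
    rw [hs, lintegral_Ioo_rpow_sub_one (neg_pos.2 hk') hy, abs_of_neg hk']

theorem lintegral_lintegral_hardyRegion {r k : ℝ} (hr : r ≠ 1) (hk : 0 < k * (r - 1))
    {f : ℝ → ℝ≥0∞} (hf : Measurable f) :
    ∫⁻ x in Set.Ioi 0, ENNReal.ofReal (x ^ (-k - 1)) * ∫⁻ y in hardyRegion r x, f y =
      ∫⁻ y in Set.Ioi 0, ENNReal.ofReal (y ^ (-k) / |k|) * f y := by
  have hE := measurableSet_hardyRegion_graph r
  have hw : Measurable fun x : ℝ => ENNReal.ofReal (x ^ (-k - 1)) := by fun_prop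
  calc
    _ = ∫⁻ x in Set.Ioi 0, ∫⁻ y in Set.Ioi 0, {z : ℝ × ℝ | z.2 ∈ hardyRegion r z.1}.indicator
          (fun z => ENNReal.ofReal (z.1 ^ (-k - 1)) * f z.2) (x, y) := by
      refine setLIntegral_congr_fun measurableSet_Ioi fun x hx => ?_
      rw [← lintegral_const_mul _ hf, ← inter_eq_self_of_subset_left
        (hardyRegion_subset_Ioi (r := r) (Set.mem_Ioi.1 hx)),
        ← Measure.restrict_restrict (measurableSet_hardyRegion r x),
        ← lintegral_indicator (measurableSet_hardyRegion r x)]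
      rfl
    _ = ∫⁻ y in Set.Ioi 0, ∫⁻ x in Set.Ioi 0, {z : ℝ × ℝ | z.2 ∈ hardyRegion r z.1}.indicator
          (fun z => ENNReal.ofReal (z.1 ^ (-k - 1)) * f z.2) (x, y) :=
      lintegral_lintegral_swap (Measurable.indicator
        ((hw.comp measurable_fst).mul (hf.comp measurable_snd)) hE).aemeasurable
    _ = _ := by
      refine setLIntegral_congr_fun measurableSet_Ioi fun y hy => ?_
      have hs : MeasurableSet {x | y ∈ hardyRegion r x} := hE.preimage measurable_prodMk_right
      have hset : {x | 0 < x ∧ y ∈ hardyRegion r x} =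
          {x | y ∈ hardyRegion r x} ∩ Set.Ioi 0 := by
        ext x
        exact and_comm
      rw [← lintegral_mem_hardyRegion_rpow hr hk hy, ← lintegral_mul_const _ hw, hset,
        ← Measure.restrict_restrict hs, ← lintegral_indicator hs]
      rfl

theorem lintegral_rpow_le_measure_univ_rpow_mul {α : Type*} [MeasurableSpace α] {μ : Measure α}
    {f : α → ℝ≥0∞} (hf : AEMeasurable f μ) {p : ℝ} (hp : 1 ≤ p) :
    (∫⁻ a, f a ∂μ) ^ p ≤ μ Set.univ ^ (p - 1) * ∫⁻ a, f a ^ p ∂μ := by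
  have hp0 : 0 < p := by linarith
  have h := eLpNorm'_le_eLpNorm'_mul_rpow_measure_univ one_pos hp hf.aestronglyMeasurable
  simp only [eLpNorm', enorm_eq_self, ENNReal.rpow_one, div_one] at h
  have h2 := ENNReal.rpow_le_rpow h hp0.le
  rw [ENNReal.mul_rpow_of_nonneg _ _ hp0.le, ← ENNReal.rpow_mul, ← ENNReal.rpow_mul,
    one_div_mul_cancel hp0.ne', ENNReal.rpow_one, mul_comm, sub_mul,
    one_div_mul_cancel hp0.ne', one_mul] at h2
  exact h2

theorem lintegral_hardy_rpow_le {r p : ℝ} (hr : r ≠ 1) (hp : 1 ≤ p)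
    {G : ℝ → ℝ≥0∞} (hG : Measurable G) :
    ∫⁻ x in Set.Ioi 0, ENNReal.ofReal (x ^ (-r)) *
        (∫⁻ y in hardyRegion r x, ENNReal.ofReal y⁻¹ * G y) ^ p ≤
      ENNReal.ofReal (p / |r - 1|) ^ p *
        ∫⁻ y in Set.Ioi 0, ENNReal.ofReal (y ^ (-r)) * G y ^ p := by
  have hp0 : 0 < p := by linarith
  have hr' : r - 1 ≠ 0 := sub_ne_zero.2 hr
  set k := (r - 1) / p with hk_def
  have hkp : k * p = r - 1 := div_mul_cancel₀ _ hp0.ne'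
  have hk0 : k ≠ 0 := div_ne_zero hr' hp0.ne'
  have hka : 0 < |k| := abs_pos.2 hk0
  have hk : 0 < k * (r - 1) := by
    rw [← hkp]
    have : 0 < k ^ 2 := by positivity
    nlinarith
  have hconst : p / |r - 1| = |k|⁻¹ := by
    rw [hk_def, abs_div, abs_of_pos hp0, inv_div]
  have hwm : Measurable fun y : ℝ => ENNReal.ofReal (y ^ (k - 1)) := by fun_prop
  have jensen : ∀ x ∈ Set.Ioi (0 : ℝ), ENNReal.ofReal (x ^ (-r)) *
      (∫⁻ y in hardyRegion r x, ENNReal.ofReal y⁻¹ * G y) ^ p ≤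
      ENNReal.ofReal (|k|⁻¹ ^ (p - 1)) * (ENNReal.ofReal (x ^ (-k - 1)) *
        ∫⁻ y in hardyRegion r x, ENNReal.ofReal (y ^ (k - r)) * G y ^ p) := by
    intro x hx
    have hx : 0 < x := hx
    set ν := (volume.restrict (hardyRegion r x)).withDensity
      fun y => ENNReal.ofReal (y ^ (k - 1)) with hν
    have hfm : Measurable fun y : ℝ => ENNReal.ofReal (y ^ (-k)) * G y := by fun_prop
    have h1 := lintegral_rpow_le_measure_univ_rpow_mul (μ := ν) hfm.aemeasurable hp
    have hmass : ν Set.univ = ENNReal.ofReal (x ^ k / |k|) := by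
      rw [hν, withDensity_apply _ MeasurableSet.univ, Measure.restrict_univ,
        lintegral_hardyRegion_rpow hr hk hx]
    have hL : ∫⁻ y, ENNReal.ofReal (y ^ (-k)) * G y ∂ν =
        ∫⁻ y in hardyRegion r x, ENNReal.ofReal y⁻¹ * G y := by
      rw [hν, lintegral_withDensity_eq_lintegral_mul _ hwm hfm]
      refine setLIntegral_congr_fun (measurableSet_hardyRegion r x) fun y hy => ?_
      have hy0 : 0 < y := hardyRegion_subset_Ioi hx hy
      simp only [Pi.mul_apply]
      rw [← mul_assoc, ← ENNReal.ofReal_mul (by positivity), ← Real.rpow_add hy0,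
        ← Real.rpow_neg_one]
      congr 3
      ring
    have hR : ∫⁻ y, (ENNReal.ofReal (y ^ (-k)) * G y) ^ p ∂ν =
        ∫⁻ y in hardyRegion r x, ENNReal.ofReal (y ^ (k - r)) * G y ^ p := by
      rw [hν, lintegral_withDensity_eq_lintegral_mul _ hwm (hfm.pow_const p)]
      refine setLIntegral_congr_fun (measurableSet_hardyRegion r x) fun y hy => ?_
      have hy0 : 0 < y := hardyRegion_subset_Ioi hx hy
      simp only [Pi.mul_apply]
      rw [ENNReal.mul_rpow_of_nonneg _ _ hp0.le, ← mul_assoc,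
        ENNReal.ofReal_rpow_of_pos (by positivity), ← Real.rpow_mul hy0.le,
        ← ENNReal.ofReal_mul (by positivity), ← Real.rpow_add hy0]
      congr 3
      linarith
    rw [hL, hR, hmass] at h1
    calc
      _ ≤ ENNReal.ofReal (x ^ (-r)) * (ENNReal.ofReal (x ^ k / |k|) ^ (p - 1) *
          ∫⁻ y in hardyRegion r x, ENNReal.ofReal (y ^ (k - r)) * G y ^ p) := by gcongr
      _ = _ := by
        rw [← mul_assoc, ← mul_assoc, ENNReal.ofReal_rpow_of_pos (by positivity),
          ← ENNReal.ofReal_mul (by positivity), ← ENNReal.ofReal_mul (by positivity),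
          div_eq_mul_inv, Real.mul_rpow (by positivity) (by positivity), ← Real.rpow_mul hx.le,
          ← mul_assoc, ← Real.rpow_add hx, mul_comm (x ^ _)]
        congr 4
        linarith
  calc
    _ ≤ ∫⁻ x in Set.Ioi 0, ENNReal.ofReal (|k|⁻¹ ^ (p - 1)) * (ENNReal.ofReal (x ^ (-k - 1)) *
        ∫⁻ y in hardyRegion r x, ENNReal.ofReal (y ^ (k - r)) * G y ^ p) :=
      setLIntegral_mono' measurableSet_Ioi jensen
    _ = ENNReal.ofReal (|k|⁻¹ ^ (p - 1)) * ∫⁻ y in Set.Ioi 0,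
        ENNReal.ofReal (y ^ (-k) / |k|) * (ENNReal.ofReal (y ^ (k - r)) * G y ^ p) := by
      rw [lintegral_const_mul' _ _ ENNReal.ofReal_ne_top,
        lintegral_lintegral_hardyRegion hr hk (by fun_prop)]
    _ = _ := by
      rw [hconst, ← lintegral_const_mul' _ _ ENNReal.ofReal_ne_top,
        ← lintegral_const_mul' _ _ (by finiteness)]
      refine setLIntegral_congr_fun measurableSet_Ioi fun y hy => ?_
      have hy : 0 < y := hy
      rw [← mul_assoc, ← mul_assoc, ← mul_assoc, ENNReal.ofReal_rpow_of_pos (by positivity),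
        ← ENNReal.ofReal_mul (by positivity), ← ENNReal.ofReal_mul (by positivity),
        ← ENNReal.ofReal_mul (by positivity)]
      congr 2
      have e1 : |k|⁻¹ ^ p = |k|⁻¹ ^ (p - 1) * |k|⁻¹ := by
        rw [← Real.rpow_add_one (by positivity), sub_add_cancel]
      have e2 : y ^ (-r) = y ^ (-k) * y ^ (k - r) := by
        rw [← Real.rpow_add hy]
        congr 1
        ring
      rw [e1, e2]
      ring

theorem lintegral_muR (r : ℝ) (f : ℝ → ℝ≥0∞) :
    ∫⁻ x, f x ∂muR r = ∫⁻ x in Set.Ioi 0, ENNReal.ofReal (x ^ (-r)) * f x :=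
  lintegral_withDensity_eq_lintegral_mul_non_measurable _ (by fun_prop)
    (Eventually.of_forall fun _ => ENNReal.ofReal_lt_top) _

theorem eLpNorm_muR {r p : ℝ} (hp : 0 < p) (f : ℝ → ℝ) :
    eLpNorm f (ENNReal.ofReal p) (muR r) =
      (∫⁻ x in Set.Ioi 0, ENNReal.ofReal (x ^ (-r)) * ‖f x‖ₑ ^ p) ^ (1 / p) := by
  rw [eLpNorm_eq_eLpNorm' (by simpa using hp) ENNReal.ofReal_ne_top, ENNReal.toReal_ofReal hp.le,
    eLpNorm', lintegral_muR]

/-- A possibly non-measurable `g` may be replaced by a measurable minorant of `‖g‖ₑ` that still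
controls all the (convergent) Hardy integrals of `g`. -/
theorem exists_measurable_hardy_majorant (r : ℝ) (g : ℝ → ℝ) :
    ∃ G : ℝ → ℝ≥0∞, Measurable G ∧ (∀ᵐ y ∂volume.restrict (Set.Ioi 0), G y ≤ ‖g y‖ₑ) ∧
      ∀ x, 0 < x → ‖∫ y in hardyRegion r x, y⁻¹ * g y‖ₑ ≤
        ∫⁻ y in hardyRegion r x, ENNReal.ofReal y⁻¹ * G y := by
  set Q : Set ℚ := {q | (0 : ℝ) < q ∧
    AEStronglyMeasurable g (volume.restrict (hardyRegion r q))} with hQ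
  set S : Set ℝ := ⋃ q : Q, hardyRegion r q with hS
  have hSm : MeasurableSet S := MeasurableSet.iUnion fun q => measurableSet_hardyRegion r _
  have hgS : AEStronglyMeasurable g (volume.restrict S) :=
    aestronglyMeasurable_iUnion_iff.2 fun q => q.2.2
  have hind : AEMeasurable (S.indicator fun y => ‖g y‖ₑ) volume :=
    (aemeasurable_indicator_iff hSm).2 hgS.enorm
  refine ⟨hind.mk _, hind.measurable_mk, ae_restrict_of_ae ?_, fun x hx => ?_⟩
  · filter_upwards [hind.ae_eq_mk] with y hy
    rw [← hy]
    exact Set.indicator_le_self _ _ _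
  by_cases hint : Integrable (fun y => y⁻¹ * g y) (volume.restrict (hardyRegion r x))
  swap
  · simp [integral_undef hint]
  have hgx : AEStronglyMeasurable g (volume.restrict (hardyRegion r x)) := by
    have h1 : AEStronglyMeasurable (fun y => y * (y⁻¹ * g y))
        (volume.restrict (hardyRegion r x)) :=
      measurable_id.aestronglyMeasurable.mul hint.1
    refine h1.congr ((ae_restrict_iff' (measurableSet_hardyRegion r x)).2
      (Eventually.of_forall fun y hy => ?_))
    exact mul_inv_cancel_left₀ (ne_of_gt (hardyRegion_subset_Ioi hx hy)) _
  have hsub : hardyRegion r x ⊆ S := by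
    intro y hy
    obtain ⟨q, hyq, hqx, hq0⟩ := exists_rat_mem_hardyRegion hx hy
    exact Set.mem_iUnion.2 ⟨⟨q, hq0, hgx.mono_set hqx⟩, hyq⟩
  refine (enorm_integral_le_lintegral_enorm _).trans_eq (lintegral_congr_ae ?_)
  filter_upwards [ae_restrict_of_ae hind.ae_eq_mk,
    ae_restrict_mem (measurableSet_hardyRegion r x)] with y hy hyx
  have hy0 : 0 < y := hardyRegion_subset_Ioi hx hyx
  rw [← hy, Set.indicator_of_mem (hsub hyx), enorm_mul,
    Real.enorm_of_nonneg (inv_nonneg.2 hy0.le)]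

theorem eLpNorm_hardy_le {r p : ℝ} (hr : r ≠ 1) (hp : 1 ≤ p) {g f : ℝ → ℝ}
    (hf : ∀ x, f x = ∫ y in hardyRegion r x, y⁻¹ * g y) :
    eLpNorm f (ENNReal.ofReal p) (muR r) ≤
      ENNReal.ofReal (p / |r - 1|) * eLpNorm g (ENNReal.ofReal p) (muR r) := by
  have hp0 : 0 < p := by linarith
  obtain ⟨G, hGm, hGg, hG⟩ := exists_measurable_hardy_majorant r g
  rw [eLpNorm_muR hp0, eLpNorm_muR hp0]
  calc
    _ ≤ (∫⁻ x in Set.Ioi 0, ENNReal.ofReal (x ^ (-r)) *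
          (∫⁻ y in hardyRegion r x, ENNReal.ofReal y⁻¹ * G y) ^ p) ^ (1 / p) := by
      refine ENNReal.rpow_le_rpow (setLIntegral_mono' measurableSet_Ioi fun x hx => ?_)
        (by positivity)
      rw [hf]
      gcongr
      exact hG x hx
    _ ≤ (ENNReal.ofReal (p / |r - 1|) ^ p *
        ∫⁻ y in Set.Ioi 0, ENNReal.ofReal (y ^ (-r)) * G y ^ p) ^ (1 / p) :=
      ENNReal.rpow_le_rpow (lintegral_hardy_rpow_le hr hp hGm) (by positivity)
    _ ≤ (ENNReal.ofReal (p / |r - 1|) ^ p *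
        ∫⁻ y in Set.Ioi 0, ENNReal.ofReal (y ^ (-r)) * ‖g y‖ₑ ^ p) ^ (1 / p) := by
      refine ENNReal.rpow_le_rpow (mul_le_mul_right (lintegral_mono_ae ?_) _) (by positivity)
      filter_upwards [hGg] with y hy
      gcongr
    _ = _ := by
      rw [ENNReal.mul_rpow_of_nonneg _ _ (by positivity), ← ENNReal.rpow_mul,
        mul_one_div_cancel hp0.ne', ENNReal.rpow_one]

theorem BGLS_hardy_le {r : ℝ} (hr : r ≠ 1) {ψ : ℝ → ℝ} (hψ : PsiClass (Set.Ioi 1) ψ)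
    {g f : ℝ → ℝ} (hf : ∀ x, f x = ∫ y in hardyRegion r x, y⁻¹ * g y) :
    BGLS r (Set.Ioi 1) (fun p => p * ψ p) f ≤
      ENNReal.ofReal (|r - 1|⁻¹) * BGLS r (Set.Ioi 1) ψ g := by
  refine iSup₂_le fun p hp => ?_
  have hp1 : 1 < p := hp
  have hp0 : 0 < p := by linarith
  have hψp := hψ.2.1 p hp
  refine ENNReal.div_le_of_le_mul ?_
  have hg : eLpNorm g (ENNReal.ofReal p) (muR r) ≤
      BGLS r (Set.Ioi 1) ψ g * ENNReal.ofReal (ψ p) := by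
    rw [← ENNReal.div_le_iff (by simpa using hψp) ENNReal.ofReal_ne_top]
    exact le_iSup₂ (f := fun p (_ : p ∈ Set.Ioi (1 : ℝ)) =>
      eLpNorm g (ENNReal.ofReal p) (muR r) / ENNReal.ofReal (ψ p)) p hp
  calc
    _ ≤ ENNReal.ofReal (p / |r - 1|) * (BGLS r (Set.Ioi 1) ψ g * ENNReal.ofReal (ψ p)) :=
      (eLpNorm_hardy_le hr hp1.le hf).trans (by gcongr)
    _ = _ := by
      rw [div_eq_mul_inv, ENNReal.ofReal_mul hp0.le, ENNReal.ofReal_mul hp0.le]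
      ring

theorem psiClass_const_rpow_one_div {M : ℝ} (hM : 0 < M) :
    PsiClass (Set.Ioi 1) fun p => M ^ (1 / p) := by
  refine ⟨fun p hp => ?_, fun p _ => by positivity, min 1 M, by positivity, fun p hp => ?_⟩
  · have hp : 1 < p := hp
    exact (ContinuousAt.rpow continuousAt_const
      (continuousAt_const.div continuousAt_id (by simp; linarith))
      (Or.inl hM.ne')).continuousWithinAt
  · have hp : 1 < p := hp
    have h1 : 1 / p ≤ 1 := (div_le_one (by linarith)).2 hp.le
    rcases le_total 1 M with h | h
    · exact (min_le_left _ _).trans (Real.one_le_rpow h (by positivity))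
    · refine (min_le_right _ _).trans ?_
      simpa using Real.rpow_le_rpow_of_exponent_ge hM h h1

/-- The set `{x > 0 | 1 ∈ hardyRegion r x}`, which is `(1, ∞)` for `r > 1` and `(0, 1)` for
`r < 1`; the Hardy operator is nearly extremal on its indicator function as `p → 1`. -/
def hardySupport (r : ℝ) : Set ℝ := {x | 0 < x ∧ (1 : ℝ) ∈ hardyRegion r x}

theorem measurableSet_hardySupport (r : ℝ) : MeasurableSet (hardySupport r) :=
  measurableSet_Ioi.inter ((measurableSet_hardyRegion_graph r).preimage measurable_prodMk_right)

theorem hardyRegion_inter_hardySupport_subset (r x : ℝ) :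
    hardyRegion r x ∩ hardySupport r ⊆ Set.Icc (min 1 x) (max 1 x) := by
  unfold hardySupport hardyRegion
  split_ifs
  · exact fun y hy => ⟨(min_le_left _ _).trans hy.2.2.2.le, hy.1.2.le.trans (le_max_right _ _)⟩
  · exact fun y hy => ⟨(min_le_right _ _).trans (le_of_lt hy.1),
      (le_of_lt hy.2.2).trans (le_max_left _ _)⟩

theorem disjoint_hardyRegion_hardySupport {r x : ℝ} (hx : 0 < x) (hxT : x ∉ hardySupport r) :
    hardyRegion r x ∩ hardySupport r = ∅ := by
  unfold hardySupport hardyRegion at *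
  split_ifs at *
  · ext y
    simp only [Set.mem_ofPred_eq, Set.mem_inter_iff, Set.mem_Ioo, Set.mem_empty_iff_false] at *
    grind
  · ext y
    simp only [Set.mem_ofPred_eq, Set.mem_inter_iff, Set.mem_Ioi, Set.mem_empty_iff_false] at *
    grind

theorem enorm_hardy_indicator {r x : ℝ} (hx : 0 < x) :
    ‖∫ y in hardyRegion r x, y⁻¹ * (hardySupport r).indicator (fun _ => (1 : ℝ)) y‖ₑ =
      ∫⁻ y in hardyRegion r x, ENNReal.ofReal y⁻¹ * (hardySupport r).indicator 1 y := by
  have hT := measurableSet_hardySupport r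
  have hfun : (fun y => y⁻¹ * (hardySupport r).indicator (fun _ => (1 : ℝ)) y) =
      (hardySupport r).indicator fun y => y⁻¹ := by
    ext y
    by_cases hy : y ∈ hardySupport r <;> simp [hy]
  have hint : Integrable (fun y => y⁻¹ * (hardySupport r).indicator (fun _ => (1 : ℝ)) y)
      (volume.restrict (hardyRegion r x)) := by
    rw [hfun, integrable_indicator_iff hT, IntegrableOn, Measure.restrict_restrict hT,
      Set.inter_comm]
    refine IntegrableOn.mono_set ?_ (hardyRegion_inter_hardySupport_subset r x)
    refine ContinuousOn.integrableOn_Icc (continuousOn_inv₀.mono fun y hy => ?_)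
    exact ne_of_gt ((lt_min one_pos hx).trans_le hy.1)
  have hnn : 0 ≤ᵐ[volume.restrict (hardyRegion r x)]
      fun y => y⁻¹ * (hardySupport r).indicator (fun _ => (1 : ℝ)) y := by
    filter_upwards [ae_restrict_mem (measurableSet_hardyRegion r x)] with y hy
    have hy0 : 0 < y := hardyRegion_subset_Ioi hx hy
    exact mul_nonneg (inv_nonneg.2 hy0.le) (Set.indicator_nonneg (fun _ _ => zero_le_one) _)
  rw [Real.enorm_of_nonneg (integral_nonneg_of_ae hnn),
    ofReal_integral_eq_lintegral_ofReal hint hnn]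
  refine lintegral_congr fun y => ?_
  by_cases hy : y ∈ hardySupport r <;> simp [hy]

theorem lintegral_hardySupport {r : ℝ} (hr : r ≠ 1) :
    ∫⁻ x in hardySupport r, ENNReal.ofReal (x ^ (-r)) = ENNReal.ofReal |r - 1|⁻¹ := by
  have hk : 0 < (r - 1) * (r - 1) := mul_self_pos.2 (sub_ne_zero.2 hr)
  have := lintegral_mem_hardyRegion_rpow hr hk one_pos
  rw [Real.one_rpow, one_div, show -(r - 1) - 1 = -r by ring] at this
  exact this

theorem hardySupport_subset_Ioi (r : ℝ) : hardySupport r ⊆ Set.Ioi 0 := fun _ hx => hx.1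

theorem setLIntegral_hardySupport (r : ℝ) (u : ℝ → ℝ≥0∞) :
    ∫⁻ x in hardySupport r, u x = ∫⁻ x in Set.Ioi 0, (hardySupport r).indicator u x := by
  have hT := measurableSet_hardySupport r
  rw [lintegral_indicator hT, Measure.restrict_restrict hT,
    inter_eq_self_of_subset_left (hardySupport_subset_Ioi r)]

theorem lintegral_rpow_indicator_hardySupport {r : ℝ} (hr : r ≠ 1) :
    ∫⁻ x in Set.Ioi 0, ENNReal.ofReal (x ^ (-r)) * (hardySupport r).indicator 1 x =
      ENNReal.ofReal |r - 1|⁻¹ := by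
  rw [← lintegral_hardySupport hr, setLIntegral_hardySupport]
  refine lintegral_congr fun y => ?_
  by_cases hy : y ∈ hardySupport r <;> simp [hy]

theorem eLpNorm_indicator_hardySupport {r p : ℝ} (hr : r ≠ 1) (hp : 0 < p) :
    eLpNorm ((hardySupport r).indicator fun _ => (1 : ℝ)) (ENNReal.ofReal p) (muR r) =
      ENNReal.ofReal (|r - 1|⁻¹ ^ (1 / p)) := by
  have hM : 0 < |r - 1|⁻¹ := inv_pos.2 (abs_pos.2 (sub_ne_zero.2 hr))
  rw [eLpNorm_muR hp, ← ENNReal.ofReal_rpow_of_pos hM, ← lintegral_rpow_indicator_hardySupport hr]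
  congr 1
  refine lintegral_congr fun y => ?_
  by_cases hy : y ∈ hardySupport r <;> simp [hy, hp]

theorem le_eLpNorm_hardy_indicator {r p : ℝ} (hr : r ≠ 1) (hp : 1 ≤ p) {f : ℝ → ℝ}
    (hf : ∀ x, f x =
      ∫ y in hardyRegion r x, y⁻¹ * (hardySupport r).indicator (fun _ => (1 : ℝ)) y) :
    ENNReal.ofReal (|r - 1|⁻¹ * |r - 1|⁻¹ ^ (1 / p)) ≤
      eLpNorm f (ENNReal.ofReal p) (muR r) := by
  have hp0 : 0 < p := by linarith
  have hM : 0 < |r - 1|⁻¹ := inv_pos.2 (abs_pos.2 (sub_ne_zero.2 hr))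
  set M := |r - 1|⁻¹ with hM_def
  have hk : 0 < (r - 1) * (r - 1) := mul_self_pos.2 (sub_ne_zero.2 hr)
  have hT := measurableSet_hardySupport r
  have hwm : Measurable fun x : ℝ => ENNReal.ofReal (x ^ (-r)) := by fun_prop
  set φ : ℝ → ℝ≥0∞ := fun y => ENNReal.ofReal y⁻¹ * (hardySupport r).indicator 1 y with hφ_def
  have hφ : Measurable φ :=
    (ENNReal.measurable_ofReal.comp measurable_inv).mul (measurable_one.indicator hT)
  set H : ℝ → ℝ≥0∞ := fun x => ∫⁻ y in hardyRegion r x, φ y with hH_def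
  have hHm : Measurable H := by
    have : H = fun x => ∫⁻ y, {z : ℝ × ℝ | z.2 ∈ hardyRegion r z.1}.indicator
        (fun z => φ z.2) (x, y) := by
      ext x
      rw [hH_def]
      simp only
      rw [← lintegral_indicator (measurableSet_hardyRegion r x)]
      rfl
    rw [this]
    exact Measurable.lintegral_prod_right
      ((hφ.comp measurable_snd).indicator (measurableSet_hardyRegion_graph r))
  have hfH : ∀ x, 0 < x → ‖f x‖ₑ = H x := fun x hx => by rw [hf, enorm_hardy_indicator hx]
  have hH0 : ∀ x, 0 < x → x ∉ hardySupport r → H x = 0 := fun x hx hxT => by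
    rw [← hfH x hx, hf]
    have : ∀ y ∈ hardyRegion r x,
        y⁻¹ * (hardySupport r).indicator (fun _ => (1 : ℝ)) y = 0 := fun y hy => by
      have hyT : y ∉ hardySupport r := fun h =>
        (Set.ext_iff.1 (disjoint_hardyRegion_hardySupport hx hxT) y).1 ⟨hy, h⟩
      simp [hyT]
    rw [setIntegral_congr_fun (measurableSet_hardyRegion r x) this]
    simp
  have hL1 : ∫⁻ x in hardySupport r, ENNReal.ofReal (x ^ (-r)) * H x = ENNReal.ofReal (M * M) := by
    calc
      _ = ∫⁻ x in Set.Ioi 0, ENNReal.ofReal (x ^ (-(r - 1) - 1)) * H x := by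
        rw [setLIntegral_hardySupport]
        refine setLIntegral_congr_fun measurableSet_Ioi fun x hx => ?_
        rw [show -(r - 1) - 1 = -r by ring]
        by_cases hxT : x ∈ hardySupport r
        · simp [hxT]
        · simp [hxT, hH0 x hx hxT]
      _ = ∫⁻ y in Set.Ioi 0, ENNReal.ofReal (y ^ (-(r - 1)) / |r - 1|) * φ y :=
        lintegral_lintegral_hardyRegion hr hk hφ
      _ = ∫⁻ y in Set.Ioi 0, ENNReal.ofReal M *
          (ENNReal.ofReal (y ^ (-r)) * (hardySupport r).indicator 1 y) := by
        refine setLIntegral_congr_fun measurableSet_Ioi fun y hy => ?_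
        have hy : 0 < y := hy
        simp only [hφ_def]
        rw [← mul_assoc, ← mul_assoc, ← ENNReal.ofReal_mul (by positivity),
          ← ENNReal.ofReal_mul hM.le]
        congr 2
        rw [div_eq_mul_inv, ← hM_def, mul_comm _ M, mul_assoc, ← Real.rpow_neg_one y,
          ← Real.rpow_add hy]
        congr 2
        ring
      _ = _ := by
        rw [lintegral_const_mul' _ _ ENNReal.ofReal_ne_top,
          lintegral_rpow_indicator_hardySupport hr, ← ENNReal.ofReal_mul hM.le]
  have h1 := lintegral_rpow_le_measure_univ_rpow_mul
    (μ := (volume.restrict (hardySupport r)).withDensity fun x => ENNReal.ofReal (x ^ (-r)))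
    hHm.aemeasurable hp
  rw [lintegral_withDensity_eq_lintegral_mul _ hwm hHm,
    lintegral_withDensity_eq_lintegral_mul _ hwm (hHm.pow_const p),
    withDensity_apply _ MeasurableSet.univ, Measure.restrict_univ, lintegral_hardySupport hr] at h1
  simp only [Pi.mul_apply] at h1
  rw [hL1] at h1
  have h2 : ∫⁻ x in hardySupport r, ENNReal.ofReal (x ^ (-r)) * H x ^ p ≤
      ∫⁻ x in Set.Ioi 0, ENNReal.ofReal (x ^ (-r)) * ‖f x‖ₑ ^ p :=
    (lintegral_mono_set (hardySupport_subset_Ioi r)).trans_eq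
      (setLIntegral_congr_fun measurableSet_Ioi fun x hx => by simp only [hfH x hx])
  rw [eLpNorm_muR hp0]
  have h3 : ENNReal.ofReal (M ^ (p + 1)) ≤
      ∫⁻ x in Set.Ioi 0, ENNReal.ofReal (x ^ (-r)) * ‖f x‖ₑ ^ p := by
    refine le_trans ?_ h2
    rw [ENNReal.ofReal_rpow_of_pos (by positivity), ENNReal.ofReal_rpow_of_pos hM,
      mul_comm (ENNReal.ofReal (M ^ (p - 1)))] at h1
    have h4 := ENNReal.div_le_of_le_mul h1
    rw [← ENNReal.ofReal_div_of_pos (by positivity)] at h4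
    refine le_trans (le_of_eq ?_) h4
    congr 1
    rw [Real.mul_rpow hM.le hM.le, ← Real.rpow_add hM, ← Real.rpow_sub hM]
    congr 1
    ring
  refine le_trans (le_of_eq ?_) (ENNReal.rpow_le_rpow h3 (by positivity : 0 ≤ 1 / p))
  rw [ENNReal.ofReal_rpow_of_pos (by positivity), ← Real.rpow_mul hM.le,
    ← Real.rpow_one_add' hM.le (by positivity)]
  congr 2
  field_simp

theorem le_BGLS_hardy_indicator {r : ℝ} (hr : r ≠ 1) {f : ℝ → ℝ}
    (hf : ∀ x, f x =
      ∫ y in hardyRegion r x, y⁻¹ * (hardySupport r).indicator (fun _ => (1 : ℝ)) y) :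
    ENNReal.ofReal (|r - 1|⁻¹) ≤
      BGLS r (Set.Ioi 1) (fun p => p * |r - 1|⁻¹ ^ (1 / p)) f := by
  have hM : 0 < |r - 1|⁻¹ := inv_pos.2 (abs_pos.2 (sub_ne_zero.2 hr))
  have hlim : Tendsto (fun p : ℝ => ENNReal.ofReal (|r - 1|⁻¹ / p)) (nhdsWithin 1 (Set.Ioi 1))
      (nhds (ENNReal.ofReal (|r - 1|⁻¹))) := by
    have : ContinuousAt (fun p : ℝ => ENNReal.ofReal (|r - 1|⁻¹ / p)) 1 :=
      ENNReal.continuous_ofReal.continuousAt.comp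
        (continuousAt_const.div continuousAt_id one_ne_zero)
    have h := this.tendsto.mono_left (nhdsWithin_le_nhds (s := Set.Ioi 1))
    rwa [div_one] at h
  refine le_of_tendsto hlim ?_
  filter_upwards [self_mem_nhdsWithin] with p hp
  have hp1 : 1 < p := hp
  have hp0 : 0 < p := by linarith
  refine le_trans ?_ (le_iSup₂ (f := fun p (_ : p ∈ Set.Ioi (1 : ℝ)) =>
    eLpNorm f (ENNReal.ofReal p) (muR r) / ENNReal.ofReal (p * |r - 1|⁻¹ ^ (1 / p))) p hp)
  refine le_trans (le_of_eq ?_) (ENNReal.div_le_div_right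
    (le_eLpNorm_hardy_indicator hr hp1.le hf) _)
  rw [← ENNReal.ofReal_div_of_pos (by positivity)]
  congr 1
  exact (mul_div_mul_right _ _ (by positivity)).symm

theorem BGLS_indicator_hardySupport_le {r : ℝ} (hr : r ≠ 1) :
    BGLS r (Set.Ioi 1) (fun p => |r - 1|⁻¹ ^ (1 / p))
      ((hardySupport r).indicator fun _ => (1 : ℝ)) ≤ 1 := by
  refine iSup₂_le fun p hp => ?_
  have hp1 : 1 < p := hp
  rw [eLpNorm_indicator_hardySupport hr (by linarith)]
  exact ENNReal.div_self_le_one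

theorem indicator_hardySupport_ne_zero {r : ℝ} (hr : r ≠ 1) :
    (hardySupport r).indicator (fun _ => (1 : ℝ)) ≠ 0 := by
  intro h
  have h1 := eLpNorm_indicator_hardySupport hr one_pos
  have hM : 0 < |r - 1|⁻¹ := inv_pos.2 (abs_pos.2 (sub_ne_zero.2 hr))
  rw [h, eLpNorm_zero, eq_comm, ENNReal.ofReal_eq_zero] at h1
  exact absurd h1 (not_le.2 (by positivity))

/-- Theorem 9: the Hardy inequality `|F g|_{p,r} ≤ (p/|r-1|)|g|_{p,r}` holds,
hence `‖F g‖G(ψ₁) ≤ |r-1|⁻¹ ‖g‖G(ψ)` with `ψ₁(p) = p ψ(p)`, and `|r-1|⁻¹` is best possible. -/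
theorem weighted_hardy_bgls_exact_constant
    (r : ℝ) (hr : 0 < r) (hr1 : r ≠ 1)
    (F : (ℝ → ℝ) → ℝ → ℝ)
    (hF : ∀ g x, F g x =
      if 1 < r then ∫ y in Set.Ioo (0:ℝ) x, y⁻¹ * g y
      else ∫ y in Set.Ioi x, y⁻¹ * g y) :
    -- the Hardy inequality for `p ∈ [1,∞)`
    (∀ p ∈ Set.Ici (1:ℝ), ∀ g : ℝ → ℝ,
      eLpNorm (F g) (ENNReal.ofReal p) (muR r) ≤
        ENNReal.ofReal (p / |r - 1|) * eLpNorm g (ENNReal.ofReal p) (muR r)) ∧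
    -- the BGLS estimate with constant `|r-1|⁻¹`
    (∀ ψ : ℝ → ℝ, PsiClass (Set.Ioi 1) ψ → ∀ g : ℝ → ℝ,
      BGLS r (Set.Ioi 1) (fun p => p * ψ p) (F g) ≤
        ENNReal.ofReal (|r - 1|⁻¹) * BGLS r (Set.Ioi 1) ψ g) ∧
    -- the constant `|r-1|⁻¹` is best possible
    (⨆ ψ : ℝ → ℝ, ⨆ _ : PsiClass (Set.Ioi 1) ψ, ⨆ g : ℝ → ℝ, ⨆ _ : g ≠ 0,
      BGLS r (Set.Ioi 1) (fun p => p * ψ p) (F g) / BGLS r (Set.Ioi 1) ψ g) =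
      ENNReal.ofReal (|r - 1|⁻¹) := by
  have hF' : ∀ g x, F g x = ∫ y in hardyRegion r x, y⁻¹ * g y := fun g x => by
    rw [hF, hardyRegion]
    split_ifs <;> rfl
  refine ⟨fun p hp g => eLpNorm_hardy_le hr1 hp (hF' g),
    fun ψ hψ g => BGLS_hardy_le hr1 hψ (hF' g), le_antisymm ?_ ?_⟩
  · exact iSup₂_le fun ψ hψ => iSup₂_le fun g _ =>
      ENNReal.div_le_of_le_mul (BGLS_hardy_le hr1 hψ (hF' g))
  · have hM : 0 < |r - 1|⁻¹ := inv_pos.2 (abs_pos.2 (sub_ne_zero.2 hr1))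
    refine le_iSup₂_of_le _ (psiClass_const_rpow_one_div hM) <|
      le_iSup₂_of_le _ (indicator_hardySupport_ne_zero hr1) ?_
    calc
      _ ≤ BGLS r (Set.Ioi 1) (fun p => p * |r - 1|⁻¹ ^ (1 / p)) _ :=
        le_BGLS_hardy_indicator hr1 (hF' _)
      _ = BGLS r (Set.Ioi 1) (fun p => p * |r - 1|⁻¹ ^ (1 / p)) _ / 1 := (div_one _).symm
      _ ≤ _ := ENNReal.div_le_div_left (BGLS_indicator_hardySupport_le hr1) _
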